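/- Suppose K(r) ≥ k for all r ∈ [0,R], and additionally R ≤ π/√k in case k > 0. Then for every natural number n ≥ 2, every r ∈ (0,R], and all real numbers A ≥ 0 and B ≥ 0, one has (A + B/σ(r)²)·σ(r)^(n−1) ≤ (sin_k(R)/σ(R))² · (A + B/sin_k(r)²)·sin_k(r)^(n−1). -/

import Mathlib

open Real

/-- The generalized sine function `sin_k`: the solution of `y'' + k y = 0`,
`y 0 = 0`, `y' 0 = 1`. -/
noncomputable def sinK (k r : ℝ) : ℝ :=
  if k = 0 then r
  else if 0 < k then Real.sin (Real.sqrt k * r) / Real.sqrt k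
  else Real.sinh (Real.sqrt (-k) * r) / Real.sqrt (-k)

theorem sinK_props (k : ℝ) : ∃ c : ℝ → ℝ, (∀ r, HasDerivAt (sinK k) (c r) r) ∧
    (∀ r, HasDerivAt c (-k * sinK k r) r) ∧ c 0 = 1 ∧ sinK k 0 = 0 := by
  rcases lt_trichotomy k 0 with h | h | h
  · have hs : 0 < Real.sqrt (-k) := Real.sqrt_pos.2 (by linarith)
    have hs2 : Real.sqrt (-k) * Real.sqrt (-k) = -k := Real.mul_self_sqrt (by linarith)
    have e : sinK k = fun r => Real.sinh (Real.sqrt (-k) * r) / Real.sqrt (-k) := by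
      funext r; simp [sinK, h.ne, not_lt.2 h.le]
    rw [e]
    refine ⟨fun r => Real.cosh (Real.sqrt (-k) * r), fun r => ?_, fun r => ?_, by simp, by simp⟩
    · have := (((hasDerivAt_id r).const_mul (Real.sqrt (-k))).sinh).div_const (Real.sqrt (-k))
      refine this.congr_deriv ?_
      simp only [id]; field_simp
    · have := (((hasDerivAt_id r).const_mul (Real.sqrt (-k))).cosh)
      refine this.congr_deriv ?_
      simp only [id]
      generalize Real.sqrt (-k) = w at *
      rw [← hs2]; field_simp
  · subst h
    have e : sinK 0 = fun r => r := by funext r; simp [sinK]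
    rw [e]
    refine ⟨fun _ => 1, fun r => hasDerivAt_id r, fun r => ?_, rfl, rfl⟩
    simpa using hasDerivAt_const r (1:ℝ)
  · have hs : 0 < Real.sqrt k := Real.sqrt_pos.2 h
    have hs2 : Real.sqrt k * Real.sqrt k = k := Real.mul_self_sqrt h.le
    have e : sinK k = fun r => Real.sin (Real.sqrt k * r) / Real.sqrt k := by
      funext r; simp [sinK, h.ne', h]
    rw [e]
    refine ⟨fun r => Real.cos (Real.sqrt k * r), fun r => ?_, fun r => ?_, by simp, by simp⟩
    · have := (((hasDerivAt_id r).const_mul (Real.sqrt k)).sin).div_const (Real.sqrt k)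
      refine this.congr_deriv ?_
      simp only [id]; field_simp
    · have := (((hasDerivAt_id r).const_mul (Real.sqrt k)).cos)
      refine this.congr_deriv ?_
      have : -k = -(Real.sqrt k * Real.sqrt k) := by rw [hs2]
      simp only [id]; rw [this]; field_simp

theorem sinK_nonneg (k R : ℝ) (hRk : 0 < k → R ≤ π / Real.sqrt k) (r : ℝ)
    (hr : r ∈ Set.Icc 0 R) : 0 ≤ sinK k r := by
  unfold sinK
  split_ifs with h1 h2
  · exact hr.1
  · have hs : 0 < Real.sqrt k := Real.sqrt_pos.2 h2
    refine div_nonneg (Real.sin_nonneg_of_nonneg_of_le_pi (mul_nonneg hs.le hr.1) ?_) hs.le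
    have := (le_div_iff₀ hs).1 (hr.2.trans (hRk h2))
    linarith
  · exact div_nonneg (Real.sinh_nonneg_iff.2 (mul_nonneg (Real.sqrt_nonneg _) hr.1))
      (Real.sqrt_nonneg _)

/-- Pointwise integrand comparison: if `K ≥ k` on `[0,R]` (and `R ≤ π/√k`
when `k > 0`), then for `n ≥ 2`, `r ∈ (0,R]`, and `A, B ≥ 0`,
`(A + B/σ(r)²)·σ(r)^(n−1) ≤ (sin_k(R)/σ(R))²·(A + B/sin_k(r)²)·sin_k(r)^(n−1)`. -/
theorem integrand_upper_bound
    (R k : ℝ) (hR : 0 < R) (σ σ' σ'' K : ℝ → ℝ)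
    (hderiv : ∀ r ∈ Set.Icc 0 R, HasDerivAt σ (σ' r) r)
    (hderiv' : ∀ r ∈ Set.Icc 0 R, HasDerivAt σ' (σ'' r) r)
    (hcont : ContinuousOn σ'' (Set.Icc 0 R))
    (hσ0 : σ 0 = 0) (hσ'0 : σ' 0 = 1)
    (hσpos : ∀ r ∈ Set.Ioc 0 R, 0 < σ r)
    (hODE : ∀ r ∈ Set.Icc 0 R, σ'' r + K r * σ r = 0)    (hk : ∀ r ∈ Set.Icc 0 R, k ≤ K r)
    (hRk : 0 < k → R ≤ π / Real.sqrt k) :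
    ∀ n : ℕ, 2 ≤ n → ∀ r ∈ Set.Ioc 0 R, ∀ A B : ℝ, 0 ≤ A → 0 ≤ B →
      (A + B / σ r ^ 2) * σ r ^ (n - 1)
        ≤ (sinK k R / σ R) ^ 2 * ((A + B / sinK k r ^ 2) * sinK k r ^ (n - 1)) := by
  obtain ⟨c, hs, hc, hc0, hs0⟩ := sinK_props k
  have hsn := sinK_nonneg k R hRk
  have hσn : ∀ r ∈ Set.Icc 0 R, 0 ≤ σ r := by
    intro r hr
    rcases hr.1.eq_or_lt with h | h
    · rw [← h, hσ0]
    · exact (hσpos r ⟨h, hr.2⟩).le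
  have hWd : ∀ r ∈ Set.Icc 0 R, HasDerivAt (fun x => c x * σ x - sinK k x * σ' x)
      ((K r - k) * (sinK k r * σ r)) r := by
    intro r hr
    refine (((hc r).mul (hderiv r hr)).sub ((hs r).mul (hderiv' r hr))).congr_deriv ?_
    linear_combination (-sinK k r) * hODE r hr
  have hWm : MonotoneOn (fun x => c x * σ x - sinK k x * σ' x) (Set.Icc 0 R) := by
    refine monotoneOn_of_hasDerivWithinAt_nonneg (convex_Icc 0 R)
      (fun r hr => (hWd r hr).continuousAt.continuousWithinAt)
      (fun r hr => (hWd r (interior_subset hr)).hasDerivWithinAt) ?_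
    intro r hr
    have hr := interior_subset hr
    exact mul_nonneg (sub_nonneg.2 (hk r hr)) (mul_nonneg (hsn r hr) (hσn r hr))
  have hW : ∀ r ∈ Set.Icc 0 R, 0 ≤ c r * σ r - sinK k r * σ' r := by
    intro r hr
    have := hWm ⟨le_rfl, hR.le⟩ hr hr.1
    simpa [hσ0, hs0] using this
  have hqd : ∀ r ∈ Set.Ioc 0 R, HasDerivAt (fun x => sinK k x / σ x)
      ((c r * σ r - sinK k r * σ' r) / σ r ^ 2) r := fun r hr =>
    (hs r).div (hderiv r ⟨hr.1.le, hr.2⟩) (hσpos r hr).ne'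
  have hqm : MonotoneOn (fun x => sinK k x / σ x) (Set.Ioc 0 R) := by
    refine monotoneOn_of_hasDerivWithinAt_nonneg (convex_Ioc 0 R)
      (fun r hr => (hqd r hr).continuousAt.continuousWithinAt)
      (fun r hr => (hqd r (interior_subset hr)).hasDerivWithinAt) ?_
    intro r hr
    have hr := interior_subset hr
    exact div_nonneg (hW r ⟨hr.1.le, hr.2⟩) (sq_nonneg _)
  have hlim : Filter.Tendsto (fun x => sinK k x / σ x) (nhdsWithin 0 (Set.Ioi 0)) (nhds 1) := by
    have h1 := (hasDerivAt_iff_tendsto_slope.1 (hs 0)).mono_left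
      (nhdsWithin_mono 0 (fun x (hx : x ∈ Set.Ioi (0:ℝ)) => (ne_of_gt hx : x ≠ 0)))
    have h2 := (hasDerivAt_iff_tendsto_slope.1 (hderiv 0 ⟨le_rfl, hR.le⟩)).mono_left
      (nhdsWithin_mono 0 (fun x (hx : x ∈ Set.Ioi (0:ℝ)) => (ne_of_gt hx : x ≠ 0)))
    have h3 := h1.div h2 (by rw [hσ'0]; norm_num)
    rw [hc0, hσ'0, div_one] at h3
    refine h3.congr' ?_
    filter_upwards [self_mem_nhdsWithin] with x hx
    have hx : x ≠ 0 := ne_of_gt hx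
    simp only [Pi.div_apply, slope_def_field, hs0, hσ0, sub_zero]
    exact div_div_div_cancel_right₀ hx _ _
  have hq1 : ∀ r ∈ Set.Ioc 0 R, 1 ≤ sinK k r / σ r := by
    intro r hr
    refine le_of_tendsto hlim ?_
    filter_upwards [Ioc_mem_nhdsGT hr.1] with x hx
    exact hqm ⟨hx.1, hx.2.trans hr.2⟩ hr hx.2
  intro n hn r hr A B hA hB
  have hσr := hσpos r hr
  have hle : σ r ≤ sinK k r := (one_le_div hσr).1 (hq1 r hr)
  have hQ : sinK k r / σ r ≤ sinK k R / σ R := hqm hr ⟨hR, le_rfl⟩ hr.2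
  have hQ1 := hq1 R ⟨hR, le_rfl⟩
  generalize sinK k R / σ R = Q at *
  generalize sinK k r = s at *
  generalize σ r = t at *
  have hspos : 0 < s := hσr.trans_le hle
  have hQ2 : Q ≤ Q ^ 2 := by nlinarith
  have hA' : A * t ^ (n - 1) ≤ Q ^ 2 * (A * s ^ (n - 1)) := by
    have h1 : A * t ^ (n - 1) ≤ A * s ^ (n - 1) := by gcongr
    have h2 : 0 ≤ A * s ^ (n - 1) := by positivity
    nlinarith
  have hB' : B / t ^ 2 * t ^ (n - 1) ≤ Q ^ 2 * (B / s ^ 2 * s ^ (n - 1)) := by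
    obtain ⟨m, rfl⟩ := Nat.exists_eq_add_of_le hn
    rcases m with _ | m
    · have e1 : B / t ^ 2 * t ^ (2 + 0 - 1) = B / s * (s / t) := by norm_num; field_simp
      have e2 : B / s ^ 2 * s ^ (2 + 0 - 1) = B / s := by norm_num; field_simp
      rw [e1, e2, mul_comm (Q ^ 2)]
      exact mul_le_mul_of_nonneg_left (hQ.trans hQ2) (by positivity)
    · have e : 2 + (m + 1) - 1 = m + 2 := by omega
      have e1 : B / t ^ 2 * t ^ (m + 2) = B * t ^ m := by rw [pow_add]; field_simp
      have e2 : B / s ^ 2 * s ^ (m + 2) = B * s ^ m := by rw [pow_add]; field_simp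
      rw [e, e1, e2]
      have h1 : B * t ^ m ≤ B * s ^ m := by gcongr
      have h2 : 0 ≤ B * s ^ m := by positivity
      nlinarith
  calc _ = A * t ^ (n - 1) + B / t ^ 2 * t ^ (n - 1) := by ring
    _ ≤ _ := add_le_add hA' hB'
    _ = _ := by ring
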